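/- Let p ∈ [1,∞) and let Q ∈ L_p(M₂) be a Dirac-form potential. For each λ ∈ ℂ let U(·,λ) be the unique absolutely continuous 2×2 matrix-valued solution of B U′(x) + Q(x)U(x) = λ U(x) a.e. on (0,1) with U(0,λ) = I. Then there exists a matrix-valued function P = P_Q on [0,1]×(0,1) such that: (i) for every x ∈ [0,1] and every λ ∈ ℂ, U(x,λ) = e^{−λxB} + ∫₀ˣ e^{−λ(x−2s)B} P(x,s) ds; (ii) for every x ∈ [0,1] the function P(x,·) belongs to L_p(M₂); (iii) the map x ↦ P(x,·) from [0,1] into L_p(M₂) is continuous; and (iv) the map Q ↦ (x ↦ P_Q(x,·)), from Dirac-form potentials in L_p(M₂) into C([0,1], L_p(M₂)), is continuous. -/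

import Mathlib

open MeasureTheory Complex Filter Set
open scoped Matrix.Norms.L2Operator ENNReal

noncomputable section

abbrev M2 := Matrix (Fin 2) (Fin 2) ℂ

def Bmat : M2 := !![0, 1; -1, 0]

def Jmat : M2 := !![1, 0; 0, -1]

/-- `expB τ = e^{-τ B} = [[cos τ, -sin τ],[sin τ, cos τ]]`. -/
def expB (τ : ℂ) : M2 := !![Complex.cos τ, -Complex.sin τ; Complex.sin τ, Complex.cos τ]

/-- Lebesgue measure restricted to `(0,1)`. -/
def μ01 : Measure ℝ := volume.restrict (Set.Ioo 0 1)

/-- Lebesgue measure restricted to `(-1,1)`. -/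
def μ11 : Measure ℝ := volume.restrict (Set.Ioo (-1) 1)

/-- A Dirac-form potential `Q = [[q₁,q₂],[q₂,-q₁]]`. -/
def IsDiracForm (Q : ℝ → M2) : Prop :=
  ∃ q1 q2 : ℝ → ℂ, ∀ x, Q x = !![q1 x, q2 x; q2 x, -q1 x]

/-- A Dirac-form potential with real-valued entries. -/
def IsRealDiracForm (Q : ℝ → M2) : Prop :=
  ∃ q1 q2 : ℝ → ℝ, ∀ x, Q x = !![(q1 x : ℂ), (q2 x : ℂ); (q2 x : ℂ), -(q1 x : ℂ)]

/-- `U` is an absolutely continuous matrix solution of `B U' + Q U = λ U` a.e. on `(0,1)`. -/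
def IsMatSolution (Q : ℝ → M2) (l : ℂ) (U : ℝ → M2) : Prop :=
  ∃ U' : ℝ → M2, IntegrableOn U' (Set.Ioo 0 1) ∧
    (∀ x ∈ Set.Icc (0:ℝ) 1, U x = U 0 + ∫ t in (0:ℝ)..x, U' t) ∧
    (∀ᵐ x ∂μ01, Bmat * U' x + Q x * U x = l • U x)

/-- `u` is an absolutely continuous `ℂ²`-valued solution of `B u' + Q u = λ u` a.e. on `(0,1)`. -/
def IsVecSolution (Q : ℝ → M2) (l : ℂ) (u : ℝ → Fin 2 → ℂ) : Prop :=
  ∃ u' : ℝ → Fin 2 → ℂ, IntegrableOn u' (Set.Ioo 0 1) ∧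
    (∀ x ∈ Set.Icc (0:ℝ) 1, u x = u 0 + ∫ t in (0:ℝ)..x, u' t) ∧
    (∀ᵐ x ∂μ01, Bmat.mulVec (u' x) + (Q x).mulVec (u x) = l • u x)

/-- `λ` is an eigenvalue of the Dirac operator `A_j` (`j = 0` for `A₁`, `j = 1` for `A₂`):
there is a nonzero AC solution with `u₂(0) = 0` and `u_j(1) = 0`. -/
def IsEigenvalue (Q : ℝ → M2) (j : Fin 2) (l : ℝ) : Prop :=
  ∃ u : ℝ → Fin 2 → ℂ, IsVecSolution Q (l : ℂ) u ∧
    (∃ x ∈ Set.Icc (0:ℝ) 1, u x ≠ 0) ∧ u 0 1 = 0 ∧ u 1 j = 0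

/-- `c₀(·,λ) = (cos λx, sin λx)ᵗ`. -/
def c0 (l : ℂ) (x : ℝ) : Fin 2 → ℂ := ![Complex.cos (l * x), Complex.sin (l * x)]

/-- n-th Fourier coefficient `e_n(g) = ∫₀¹ e^{-2πinx} g(x) dx`. -/
def fc (g : ℝ → ℂ) (n : ℤ) : ℂ :=
  ∫ x in (0:ℝ)..1, Complex.exp (-2 * Real.pi * Complex.I * n * x) * g x

/-- The square of the `ℍ = L₂((0,1),ℂ²)` norm of `u`. -/
def hnormSq (u : ℝ → Fin 2 → ℂ) : ℝ :=
  ∫ x in Set.Ioo (0:ℝ) 1, (‖u x 0‖ ^ 2 + ‖u x 1‖ ^ 2)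

/-- The `ℂ²` inner product `⟨v,w⟩ = v₁ w̄₁ + v₂ w̄₂`. -/
def ip2 (v w : Fin 2 → ℂ) : ℂ := v 0 * star (w 0) + v 1 * star (w 1)

/-- The eigenvalue asymptotics `λ_n = π(n+1/2) + e_n(g)` for some `g ∈ L_p(0,1)`. -/
def LamAsymp (p : ℝ≥0∞) (lam : ℤ → ℝ) : Prop :=
  ∃ g : ℝ → ℂ, MemLp g p μ01 ∧
    ∀ n : ℤ, (lam n : ℂ) = Real.pi * (n + 1/2) + fc g n

/-- The eigenvalue asymptotics `μ_n = πn + e_n(g)` for some `g ∈ L_p(0,1)`. -/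
def MuAsymp (p : ℝ≥0∞) (mu : ℤ → ℝ) : Prop :=
  ∃ g : ℝ → ℂ, MemLp g p μ01 ∧
    ∀ n : ℤ, (mu n : ℂ) = Real.pi * n + fc g n

/-- The norming-constant asymptotics `α_n = 1 + e_n(g)` for some `g ∈ L_p(0,1)`. -/
def AlAsymp (p : ℝ≥0∞) (al : ℤ → ℝ) : Prop :=
  ∃ g : ℝ → ℂ, MemLp g p μ01 ∧ ∀ n : ℤ, (al n : ℂ) = 1 + fc g n

/-- Membership in the class `SD_p` of spectral data. -/
def MemSD (p : ℝ≥0∞) (lam mu : ℤ → ℝ) : Prop :=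
  (∀ n : ℤ, lam (n - 1) < mu n ∧ mu n < lam n) ∧ LamAsymp p lam ∧ MuAsymp p mu

/-- Membership in the kernel space `G_p(M₂)`: all slices lie in `L_p` and the slice maps are
continuous from `[0,1]` to `L_p((0,1),M₂)`. -/
def MemGp (p : ℝ≥0∞) (K : ℝ → ℝ → M2) : Prop :=
  (∀ x ∈ Set.Icc (0:ℝ) 1, MemLp (K x) p μ01) ∧
  (∀ t ∈ Set.Icc (0:ℝ) 1, MemLp (fun x => K x t) p μ01) ∧
  (∀ x₀ ∈ Set.Icc (0:ℝ) 1, ∀ ε > (0:ℝ), ∃ δ > (0:ℝ), ∀ x ∈ Set.Icc (0:ℝ) 1,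
    |x - x₀| < δ → eLpNorm (fun t => K x t - K x₀ t) p μ01 < ENNReal.ofReal ε) ∧
  (∀ t₀ ∈ Set.Icc (0:ℝ) 1, ∀ ε > (0:ℝ), ∃ δ > (0:ℝ), ∀ t ∈ Set.Icc (0:ℝ) 1,
    |t - t₀| < δ → eLpNorm (fun x => K x t - K x t₀) p μ01 < ENNReal.ofReal ε)

/-- The norm of the space `G_p(M₂)` (as an extended real number). -/
def gpNorm (p : ℝ≥0∞) (K : ℝ → ℝ → M2) : ℝ≥0∞ :=
  max (⨆ x ∈ Set.Icc (0:ℝ) 1, eLpNorm (K x) p μ01)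
      (⨆ t ∈ Set.Icc (0:ℝ) 1, eLpNorm (fun x => K x t) p μ01)


section

open MeasureTheory Complex Filter Set
open scoped Matrix.Norms.L2Operator ENNReal


lemma ac_of_dist_le {X Y Z : Type*} [PseudoMetricSpace X] [PseudoMetricSpace Y]
    [PseudoMetricSpace Z] {f : ℝ → X} {g : ℝ → Y} {h : ℝ → Z} {a b : ℝ} (C : ℝ)
    (hg : AbsolutelyContinuousOnInterval g a b) (hh : AbsolutelyContinuousOnInterval h a b)
    (H : ∀ x ∈ uIcc a b, ∀ y ∈ uIcc a b,
      dist (f x) (f y) ≤ C * (dist (g x) (g y) + dist (h x) (h y))) :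
    AbsolutelyContinuousOnInterval f a b := by
  unfold AbsolutelyContinuousOnInterval at hg hh
  apply squeeze_zero' ?_ ?_
    (by simpa using (hg.add hh).const_mul C)
  · exact Filter.Eventually.of_forall <| fun _ ↦ Finset.sum_nonneg (fun i hi ↦ dist_nonneg)
  rw [eventually_inf_principal]
  filter_upwards with (n, I) hnI
  simp only [Finset.mul_sum, ← Finset.sum_add_distrib]
  gcongr with i hi
  simp only [AbsolutelyContinuousOnInterval.disjWithin, mem_ofPred_eq] at hnI
  exact H _ (hnI.left i hi |>.left) _ (hnI.left i hi |>.right)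

lemma ac_primitive {F : Type*} [NormedAddCommGroup F] [NormedSpace ℝ F] [CompleteSpace F]
    {f : ℝ → F} {a b : ℝ} (hf : IntervalIntegrable f volume a b) :
    AbsolutelyContinuousOnInterval (fun x ↦ ∫ v in a..x, f v) a b := by
  have h1 := hf.norm.absolutelyContinuousOnInterval_intervalIntegral (c := a) (by simp)
  refine ac_of_dist_le 1 h1 h1 ?_
  intro x hx y hy
  have hax : ∀ x ∈ uIcc a b, IntervalIntegrable f volume a x := fun x hx =>
    hf.mono_set (uIcc_subset_uIcc_left hx)
  rw [dist_eq_norm, intervalIntegral.integral_interval_sub_left (hax x hx) (hax y hy), dist_eq_norm,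
    intervalIntegral.integral_interval_sub_left (hax x hx).norm (hax y hy).norm]
  have := intervalIntegral.norm_integral_le_abs_integral_norm (f := f) (a := y) (b := x) (μ := volume)
  rw [Real.norm_eq_abs]
  linarith [abs_nonneg (∫ v in y..x, ‖f v‖)]

lemma ac_ftc {F : Type*} [NormedAddCommGroup F] [NormedSpace ℝ F] [CompleteSpace F]
    {f f' : ℝ → F} {a b : ℝ} (hf : AbsolutelyContinuousOnInterval f a b)
    (hf' : IntervalIntegrable f' volume a b)
    (hd : ∀ᵐ x, x ∈ uIcc a b → HasDerivAt f (f' x) x) :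
    ∀ x ∈ uIcc a b, f x = f a + ∫ t in a..x, f' t := by
  have hac := hf.sub (ac_primitive hf')
  obtain ⟨C, hC⟩ := hac.const_of_ae_hasDerivAt_zero (by
    filter_upwards [hd, hf'.ae_hasDerivAt_integral] with x h1 h2 hx
    simpa using (h1 hx).sub (h2 hx a (by simp)))
  intro x hx
  have h1 := hC x hx
  have h2 := hC a (by simp)
  simp at h1 h2
  rw [h2, ← h1]; abel

/-- key weighted estimate -/
lemma exp_weight {k : ℝ → ℝ} (hk : Integrable k) {x : ℝ} (hx : 0 ≤ x) :
    ∫ t in (0:ℝ)..x, k t * Real.exp (2 * ∫ s in (0:ℝ)..t, k s) =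
      (Real.exp (2 * ∫ s in (0:ℝ)..x, k s) - 1) / 2 := by
  set φ : ℝ → ℝ := fun t => ∫ s in (0:ℝ)..t, k s with hφ
  have hki : IntervalIntegrable k volume 0 x := hk.intervalIntegrable
  have hac : AbsolutelyContinuousOnInterval φ 0 x := ac_primitive hki
  have hcφ : Continuous φ := intervalIntegral.continuous_primitive (fun _ _ => hk.intervalIntegrable) 0
  obtain ⟨M, hM⟩ := hac.exists_bound
  have hlip : ∃ C : NNReal, LipschitzOnWith C (fun u => Real.exp (2 * u)) (Icc (-M) M) := by
    have : ContDiff ℝ 1 (fun u : ℝ => Real.exp (2 * u)) := by fun_prop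
    exact this.contDiffOn.exists_lipschitzOnWith (by norm_num) (convex_Icc _ _) isCompact_Icc
  obtain ⟨C, hC⟩ := hlip
  have hac2 : AbsolutelyContinuousOnInterval (fun t => Real.exp (2 * φ t)) 0 x := by
    refine ac_of_dist_le C hac hac ?_
    intro u hu v hv
    have h1 := hM u hu
    have h2 := hM v hv
    rw [Real.norm_eq_abs, abs_le] at h1 h2
    have := hC.dist_le_mul _ h1 _ h2
    have h3 : 0 ≤ C * dist (φ u) (φ v) := by positivity
    linarith
  have := ac_ftc (f' := fun t => 2 * (k t * Real.exp (2 * φ t))) hac2 ?_ ?_ x (by simp)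
  · rw [intervalIntegral.integral_const_mul] at this
    have h0 : φ 0 = 0 := by simp [hφ]
    simp only [h0] at this
    simp at this
    simp only [hφ] at this ⊢
    linarith
  · exact (hki.mul_continuousOn (by fun_prop)).const_mul 2
  · filter_upwards [hki.ae_hasDerivAt_integral] with t ht hx
    have := ((ht hx 0 (by simp)).const_mul 2).exp
    convert! this using 1
    simp only [hφ]; ring

lemma prim_le {k : ℝ → ℝ} (hk : Integrable k) (t : ℝ) :
    (∫ s in (0:ℝ)..t, k s) ≤ ∫ s, ‖k s‖ := by
  refine (le_abs_self _).trans ?_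
  rw [← Real.norm_eq_abs]
  refine intervalIntegral.norm_integral_le_integral_norm_uIoc.trans ?_
  exact setIntegral_le_integral hk.norm (Eventually.of_forall fun _ => norm_nonneg _)

lemma gronwall_L1 {k u : ℝ → ℝ} (hk : Integrable k) (hk0 : ∀ t, 0 ≤ k t)
    (hu : ContinuousOn u (Icc 0 1)) {a : ℝ} 
    (h : ∀ x ∈ Icc (0:ℝ) 1, u x ≤ a + ∫ t in (0:ℝ)..x, k t * u t) :
    ∀ x ∈ Icc (0:ℝ) 1, u x ≤ 2 * (|a| * Real.exp (2 * ∫ s, ‖k s‖)) := by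
  set φ : ℝ → ℝ := fun t => ∫ s in (0:ℝ)..t, k s with hφ
  have hcφ : Continuous φ := intervalIntegral.continuous_primitive (fun _ _ => hk.intervalIntegrable) 0
  have hφ0 : ∀ x ∈ Icc (0:ℝ) 1, 0 ≤ φ x := fun x hx =>
    intervalIntegral.integral_nonneg hx.1 (fun t _ => hk0 t)
  obtain ⟨x0, hx0, hmax⟩ := isCompact_Icc.exists_isMaxOn (s := Icc (0:ℝ) 1) ⟨0, by simp⟩
    (f := fun x => Real.exp (-(2 * φ x)) * u x) (ContinuousOn.mul (by fun_prop) hu)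
  set m := Real.exp (-(2 * φ x0)) * u x0 with hm
  have hub : ∀ t ∈ Icc (0:ℝ) 1, u t ≤ m * Real.exp (2 * φ t) := by
    intro t ht
    have := hmax ht
    simp only [mem_ofPred_eq] at this
    have h2 := mul_le_mul_of_nonneg_right this (Real.exp_pos (2 * φ t)).le
    rwa [mul_right_comm, ← Real.exp_add, neg_add_cancel, Real.exp_zero, one_mul] at h2
  have hint : ∫ t in (0:ℝ)..x0, k t * u t ≤ ∫ t in (0:ℝ)..x0, m * (k t * Real.exp (2 * φ t)) := by
    refine intervalIntegral.integral_mono_on hx0.1 ?_ ?_ ?_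
    · refine hk.intervalIntegrable.mul_continuousOn (hu.mono ?_)
      rw [uIcc_of_le hx0.1]; exact Icc_subset_Icc_right hx0.2
    · exact (hk.intervalIntegrable.mul_continuousOn (by fun_prop)).const_mul m
    · intro t ht
      have := mul_le_mul_of_nonneg_left (hub t ⟨ht.1, ht.2.trans hx0.2⟩) (hk0 t)
      linarith
  rw [intervalIntegral.integral_const_mul, exp_weight hk hx0.1] at hint
  have hx0' := h x0 hx0
  have hE : 1 ≤ Real.exp (2 * φ x0) := Real.one_le_exp (by linarith [hφ0 x0 hx0])
  have hmu : u x0 = m * Real.exp (2 * φ x0) := by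
    rw [hm, mul_right_comm, ← Real.exp_add, neg_add_cancel, Real.exp_zero, one_mul]
  have hm2 : m ≤ 2 * |a| := by
    by_contra hcon
    push Not at hcon
    have ha := le_abs_self a
    have ha0 := abs_nonneg a
    change _ ≤ m * ((Real.exp (2 * φ x0) - 1) / 2) at hint
    nlinarith
  intro x hx
  have h1 : Real.exp (2 * φ x) ≤ Real.exp (2 * ∫ s, ‖k s‖) :=
    Real.exp_le_exp.mpr (by linarith [prim_le hk x])
  have h2 := hub x hx
  calc u x ≤ m * Real.exp (2 * φ x) := h2
    _ ≤ 2 * |a| * Real.exp (2 * φ x) := by gcongr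
    _ ≤ 2 * |a| * Real.exp (2 * ∫ s, ‖k s‖) := by gcongr
    _ = _ := by ring

theorem volterra_exists {E : Type*} [NormedAddCommGroup E] [NormedSpace ℝ E] [CompleteSpace E]
    {k : ℝ → ℝ} (hk : Integrable k) (hk0 : ∀ t, 0 ≤ k t) (A : ℝ → E → E)
    (hA0 : ∀ t f, ‖A t f‖ ≤ k t * ‖f‖) (hA : ∀ t f g, A t (f - g) = A t f - A t g)
    (hmeas : ∀ G : ℝ → E, Continuous G → AEStronglyMeasurable (fun t => A t (G t)) volume)
    {F : ℝ → E} (hF : Continuous F) :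
    ∃ P : ℝ → E, Continuous P ∧ ∀ x ∈ Icc (0:ℝ) 1, P x = F x + ∫ t in (0:ℝ)..x, A t (P t) := by
  set φ : ℝ → ℝ := fun t => ∫ s in (0:ℝ)..t, k s with hφ
  have hcφ : Continuous φ := intervalIntegral.continuous_primitive (fun _ _ => hk.intervalIntegrable) 0
  let ext : C(Icc (0:ℝ) 1, E) → ℝ → E := fun G t =>
    Real.exp (2 * φ t) • G (projIcc 0 1 zero_le_one t)
  have hext : ∀ G, Continuous (ext G) := fun G => by
    simp only [ext]; fun_prop
  have hextb : ∀ G t, ‖ext G t‖ ≤ Real.exp (2 * φ t) * ‖G‖ := fun G t => by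
    simp only [ext, norm_smul, Real.norm_eq_abs, Real.abs_exp]
    gcongr; exact G.norm_coe_le_norm _
  have hint : ∀ G, Integrable (fun t => A t (ext G t)) := fun G => by
    refine (hk.mul_const (Real.exp (2 * ∫ s, ‖k s‖) * ‖G‖)).mono' (hmeas _ (hext G)) ?_
    refine Eventually.of_forall fun t => (hA0 _ _).trans ?_
    refine mul_le_mul_of_nonneg_left ((hextb G t).trans ?_) (hk0 t)
    gcongr
    exact prim_le hk t
  let T : C(Icc (0:ℝ) 1, E) → C(Icc (0:ℝ) 1, E) := fun G =>
    ⟨fun x => Real.exp (-(2 * φ x)) • (F x + ∫ t in (0:ℝ)..x, A t (ext G t)), by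
      have : Continuous (fun x : ℝ => ∫ t in (0:ℝ)..x, A t (ext G t)) :=
        intervalIntegral.continuous_primitive (fun _ _ => (hint G).intervalIntegrable) 0
      fun_prop⟩
  have hT : ContractingWith (1/2) T := by
    refine ⟨by rw [← NNReal.coe_lt_coe]; norm_num, LipschitzWith.of_dist_le_mul fun G G' => ?_⟩
    rw [dist_eq_norm, dist_eq_norm, ContinuousMap.norm_le _ (by positivity)]
    intro x
    have hd : (T G - T G') x = Real.exp (-(2 * φ x)) • ∫ t in (0:ℝ)..x, A t (ext (G - G') t) := by
      simp only [T, ContinuousMap.sub_apply, ContinuousMap.coe_mk, ← smul_sub, add_sub_add_left_eq_sub]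
      rw [← intervalIntegral.integral_sub (hint G).intervalIntegrable (hint G').intervalIntegrable]
      simp only [← hA, ext, ContinuousMap.sub_apply, smul_sub]
    rw [hd, norm_smul, Real.norm_eq_abs, Real.abs_exp]
    have hb : ‖∫ t in (0:ℝ)..x, A t (ext (G - G') t)‖ ≤
        ∫ t in (0:ℝ)..x, (k t * Real.exp (2 * φ t)) * ‖G - G'‖ := by
      refine intervalIntegral.norm_integral_le_of_norm_le x.2.1 ?_ ?_
      · refine Eventually.of_forall fun t _ => (hA0 _ _).trans ?_
        rw [mul_assoc]
        exact mul_le_mul_of_nonneg_left (hextb _ t) (hk0 t)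
      · exact (hk.intervalIntegrable.mul_continuousOn (by fun_prop)).mul_const _
    rw [intervalIntegral.integral_mul_const, exp_weight hk x.2.1] at hb
    change _ ≤ (Real.exp (2 * φ x) - 1) / 2 * _ at hb
    calc _ ≤ Real.exp (-(2 * φ x)) * ((Real.exp (2 * φ x) - 1) / 2 * ‖G - G'‖) := by gcongr
      _ ≤ Real.exp (-(2 * φ x)) * ((Real.exp (2 * φ x)) / 2 * ‖G - G'‖) := by gcongr; linarith
      _ = (Real.exp (-(2 * φ x)) * (Real.exp (2 * φ x))) / 2 * ‖G - G'‖ := by ring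
      _ = _ := by rw [← Real.exp_add, neg_add_cancel, Real.exp_zero]; norm_num
  have hfix := hT.fixedPoint_isFixedPt
  set G := ContractingWith.fixedPoint T hT
  refine ⟨ext G, hext G, fun x hx => ?_⟩
  have h1 : G ⟨x, hx⟩ = T G ⟨x, hx⟩ := by rw [hfix]
  have h2 : ext G x = Real.exp (2 * φ x) • G ⟨x, hx⟩ := by
    simp only [ext, projIcc_of_mem zero_le_one hx]
  rw [h2, h1]
  simp only [T, ContinuousMap.coe_mk, smul_smul, ← Real.exp_add, add_neg_cancel, Real.exp_zero, one_smul]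

end

section

open MeasureTheory Complex Filter Set
open scoped Matrix.Norms.L2Operator ENNReal


abbrev LpE (p : ℝ≥0∞) := Lp M2 p (volume : Measure ℝ)

instance prob01 : IsProbabilityMeasure (volume.restrict (Ioc (0:ℝ) 1)) := ⟨by simp⟩

lemma L1bound {p : ℝ≥0∞} (hp : 1 ≤ p) {f : ℝ → M2} (hf : MemLp f p volume) :
    IntegrableOn f (Ioc 0 1) ∧ ∫ s in Ioc (0:ℝ) 1, ‖f s‖ ≤ (eLpNorm f p volume).toReal := by
  have h1 : MemLp f p (volume.restrict (Ioc (0:ℝ) 1)) := hf.restrict _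
  have h2 := eLpNorm_le_eLpNorm_of_exponent_le hp h1.1
  refine ⟨memLp_one_iff_integrable.mp (h1.mono_exponent hp), ?_⟩
  rw [integral_norm_eq_lintegral_enorm h1.1, ← eLpNorm_one_eq_lintegral_enorm]
  exact ENNReal.toReal_mono hf.2.ne (h2.trans (eLpNorm_mono_measure _ Measure.restrict_le_self))

variable {p : ℝ≥0∞} [hp : Fact (1 ≤ p)]

def indF (t : ℝ) (f : LpE p) : LpE p :=
  ((Lp.memLp f).indicator (measurableSet_Ioc (a := (0:ℝ)) (b := t))).toLp _

lemma indF_coe (t : ℝ) (f : LpE p) : indF t f =ᵐ[volume] (Ioc 0 t).indicator f := by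
  unfold indF
  exact MemLp.coeFn_toLp _

/-- multiplication by the indicator of `(0,t]` -/
def indL (t : ℝ) : LpE p →L[ℝ] LpE p :=
  LinearMap.mkContinuous
    { toFun := fun f => indF t f
      map_add' := fun f g => by
        unfold indF
        rw [← MemLp.toLp_add]
        apply MemLp.toLp_congr
        filter_upwards [Lp.coeFn_add f g] with s hs
        rw [Pi.add_apply, indicator_apply, indicator_apply, indicator_apply]
        split_ifs
        · exact hs
        · rw [add_zero]
      map_smul' := fun c f => by
        simp only [RingHom.id_apply]
        unfold indF
        rw [← MemLp.toLp_const_smul]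
        apply MemLp.toLp_congr
        filter_upwards [Lp.coeFn_smul c f] with s hs
        rw [Pi.smul_apply, indicator_apply, indicator_apply]
        split_ifs
        · exact hs
        · rw [smul_zero] } 1 (fun f => by
      simp only [LinearMap.coe_mk, AddHom.coe_mk, one_mul]
      rw [indF, Lp.norm_toLp, Lp.norm_def]
      exact ENNReal.toReal_mono (Lp.memLp f).2.ne (eLpNorm_indicator_le _))

lemma indL_coe (t : ℝ) (f : LpE p) : indL t f =ᵐ[volume] (Ioc 0 t).indicator f := by
  have : indL t f = indF t f := rfl
  rw [this]
  exact indF_coe t f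

lemma indL_norm (t : ℝ) (f : LpE p) : ‖indL t f‖ ≤ ‖f‖ := by
  have := (indL (p := p) t).le_of_opNorm_le (LinearMap.mkContinuous_norm_le _ zero_le_one _) f
  simpa using this

lemma ind_diff_le (x y s : ℝ) (f : ℝ → M2) :
    ‖(Ioc 0 y).indicator f s - (Ioc 0 x).indicator f s‖ ≤ ‖(uIoc x y).indicator f s‖ := by
  by_cases h1 : s ∈ Ioc 0 y <;> by_cases h2 : s ∈ Ioc 0 x
  · simp [h1, h2]
  · have : s ∈ uIoc x y := by rw [mem_uIoc]; grind
    simp [h1, h2, this]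
  · have : s ∈ uIoc x y := by rw [mem_uIoc]; grind
    simp [h1, h2, this]
  · simp [h1, h2]

lemma indL_diff (x y : ℝ) (f : LpE p) :
    ‖indL y f - indL x f‖ ≤ (eLpNorm ((uIoc x y).indicator f) p volume).toReal := by
  rw [Lp.norm_def]
  refine ENNReal.toReal_mono ((Lp.memLp f).indicator measurableSet_uIoc).2.ne ?_
  refine eLpNorm_mono_ae ?_
  filter_upwards [indL_coe y f, indL_coe x f, Lp.coeFn_sub (indL y f) (indL x f)] with s h1 h2 h3
  rw [h3, Pi.sub_apply, h1, h2]
  exact ind_diff_le x y s f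

lemma indL_cont (hp' : p ≠ ∞) : Continuous (fun z : LpE p × ℝ => indL z.2 z.1) := by
  refine continuous_prod_of_continuous_lipschitzWith _ 1 (fun f => ?_) (fun t => ?_)
  · rw [Metric.continuous_iff]
    intro x ε hε
    obtain ⟨δ, hδ, h⟩ := (Lp.memLp f).eLpNorm_indicator_le hp.out hp' (half_pos hε)
    refine ⟨δ, hδ, fun y hy => ?_⟩
    have h1 := h (uIoc x y) measurableSet_uIoc (by
      rw [uIoc, Real.volume_Ioc]
      apply ENNReal.ofReal_le_ofReal
      rw [max_sub_min_eq_abs, ← Real.dist_eq]; exact hy.le)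
    rw [dist_eq_norm]
    have h2 := indL_diff x y f
    have := ENNReal.toReal_mono ENNReal.ofReal_ne_top h1
    rw [ENNReal.toReal_ofReal (half_pos hε).le] at this
    linarith
  · refine LipschitzWith.of_dist_le_mul fun f g => ?_
    rw [dist_eq_norm, dist_eq_norm, ← map_sub]
    simpa using indL_norm t (f - g)

/-- reflected and truncated: `s ↦ 1_{(0,t]}(s) f(t-s)` -/
def Rop (t : ℝ) (f : LpE p) : LpE p :=
  indL t (Lp.compMeasurePreserving (fun s => t - s) (Measure.measurePreserving_sub_left volume t) f)

lemma Rop_coe (t : ℝ) (f : LpE p) :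
    Rop t f =ᵐ[volume] (Ioc 0 t).indicator (fun s => f (t - s)) := by
  have h1 := Lp.coeFn_compMeasurePreserving f (Measure.measurePreserving_sub_left volume t)
  refine (indL_coe _ _).trans ?_
  filter_upwards [h1] with s hs
  rw [indicator_apply, indicator_apply]
  split_ifs
  · exact hs
  · rfl

lemma Rop_norm (t : ℝ) (f : LpE p) : ‖Rop t f‖ ≤ ‖f‖ := by
  refine (indL_norm _ _).trans ?_
  rw [Lp.norm_compMeasurePreserving]

lemma Rop_sub (t : ℝ) (f g : LpE p) : Rop t (f - g) = Rop t f - Rop t g := by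
  simp only [Rop, map_sub]

lemma Rop_cont (hp' : p ≠ ∞) {G : ℝ → LpE p} (hG : Continuous G) :
    Continuous (fun t => Rop t (G t)) := by
  have h1 : Continuous (fun t => Lp.compMeasurePreserving (fun s => t - s)
      (Measure.measurePreserving_sub_left volume t) (G t)) := by
    let g : ℝ → C(ℝ, ℝ) := fun t => ⟨fun s => t - s, by fun_prop⟩
    have hg : Continuous g := ContinuousMap.continuous_of_continuous_uncurry _ (by
      simp only [g, Function.uncurry_def, ContinuousMap.coe_mk]; fun_prop)
    exact hG.compMeasurePreservingLp hg
      (fun t => Measure.measurePreserving_sub_left volume t) hp'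
  exact (indL_cont hp').comp (h1.prodMk continuous_id)

lemma expB_cont : Continuous expB := by
  unfold expB
  refine continuous_matrix fun i j => ?_
  fin_cases i <;> fin_cases j <;> simp <;> fun_prop

lemma expB_bdd (l : ℂ) (c : ℝ) : ∃ C : ℝ, 0 ≤ C ∧ ∀ s ∈ Icc (0:ℝ) 1, ‖expB (l * (c * s))‖ ≤ C := by
  obtain ⟨C, hC⟩ := isCompact_Icc.exists_bound_of_continuousOn (s := Icc (0:ℝ) 1)
    (f := fun s : ℝ => expB (l * (c * s))) (by
      refine (expB_cont.comp ?_).continuousOn; fun_prop)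
  exact ⟨max C 0, le_max_right _ _, fun s hs => (hC s hs).trans (le_max_left _ _)⟩

lemma Lfun_exists (l : ℂ) : ∃ L : LpE p →L[ℝ] M2, ∀ f,
    L f = ∫ s in Ioc (0:ℝ) 1, expB (l * ((-2 : ℝ) * s)) * f s := by
  obtain ⟨C, hC0, hC⟩ := expB_bdd l (-2)
  have hc : Continuous (fun s : ℝ => expB (l * ((-2 : ℝ) * s))) := expB_cont.comp (by fun_prop)
  have hi : ∀ f : LpE p, IntegrableOn (fun s : ℝ => expB (l * ((-2 : ℝ) * s)) * f s) (Ioc 0 1) := by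
    intro f
    refine (L1bound hp.out (Lp.memLp f)).1.norm.const_mul C |>.mono' ?_ ?_
    · exact hc.aestronglyMeasurable.mul (Lp.memLp f).1.restrict
    · filter_upwards [ae_restrict_mem measurableSet_Ioc] with s hs
      exact (norm_mul_le _ _).trans (by gcongr; exact hC s ⟨hs.1.le, hs.2⟩)
  refine ⟨LinearMap.mkContinuous
    { toFun := fun f => ∫ s in Ioc (0:ℝ) 1, expB (l * ((-2 : ℝ) * s)) * f s
      map_add' := fun f g => by
        rw [← integral_add (hi f) (hi g)]
        apply integral_congr_ae
        filter_upwards [ae_restrict_of_ae (Lp.coeFn_add f g)] with s hs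
        rw [hs, Pi.add_apply, mul_add]
      map_smul' := fun c f => by
        rw [RingHom.id_apply, ← integral_smul]
        apply integral_congr_ae
        filter_upwards [ae_restrict_of_ae (Lp.coeFn_smul c f)] with s hs
        rw [hs, Pi.smul_apply, mul_smul_comm] } C (fun f => ?_), fun f => rfl⟩
  simp only [LinearMap.coe_mk, AddHom.coe_mk]
  calc _ ≤ ∫ s in Ioc (0:ℝ) 1, C * ‖f s‖ := by
        refine norm_integral_le_of_norm_le ((L1bound hp.out (Lp.memLp f)).1.norm.const_mul C) ?_
        filter_upwards [ae_restrict_mem measurableSet_Ioc] with s hs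
        exact (norm_mul_le _ _).trans (by gcongr; exact hC s ⟨hs.1.le, hs.2⟩)
    _ = C * ∫ s in Ioc (0:ℝ) 1, ‖f s‖ := integral_const_mul _ _
    _ ≤ C * ‖f‖ := by gcongr; exact (L1bound hp.out (Lp.memLp f)).2

lemma L_ind {l : ℂ} {L : LpE p →L[ℝ] M2}
    (hL : ∀ f, L f = ∫ s in Ioc (0:ℝ) 1, expB (l * ((-2 : ℝ) * s)) * f s) {x : ℝ}
    (hx : x ∈ Icc (0:ℝ) 1) (f : LpE p) :
    L (indL x f) = ∫ s in (0:ℝ)..x, expB (l * ((-2 : ℝ) * s)) * f s := by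
  rw [hL, intervalIntegral.integral_of_le hx.1]
  have : (Ioc (0:ℝ) x) = Ioc 0 1 ∩ Ioc 0 x := by
    rw [inter_eq_right.mpr (Ioc_subset_Ioc_right hx.2)]
  rw [this, ← setIntegral_indicator measurableSet_Ioc]
  apply integral_congr_ae
  filter_upwards [ae_restrict_of_ae (indL_coe x f)] with s hs
  rw [hs]
  by_cases h : s ∈ Ioc 0 x <;> simp [h]

lemma expB_add (a b : ℂ) : expB (a + b) = expB a * expB b := by
  unfold expB
  rw [Complex.cos_add, Complex.sin_add]
  ext i j
  fin_cases i <;> fin_cases j <;> simp [Matrix.mul_apply, Fin.sum_univ_two] <;> ring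

lemma expB_zero : expB 0 = 1 := by
  unfold expB
  ext i j
  fin_cases i <;> fin_cases j <;> simp

lemma expB_neg_mul (a : ℂ) : expB (-a) * expB a = 1 := by
  rw [← expB_add, neg_add_cancel, expB_zero]

lemma expB_mul_neg (a : ℂ) : expB a * expB (-a) = 1 := by
  rw [← expB_add, add_neg_cancel, expB_zero]

/-- the (anti)commutation property -/
def AntiC (k : M2) : Prop := ∀ a, k * expB a = expB (-a) * k

lemma antiC_dirac (q1 q2 : ℂ) : AntiC (Bmat * !![q1, q2; q2, -q1]) := by
  intro a
  unfold expB Bmat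
  ext i j
  fin_cases i <;> fin_cases j <;> simp [Matrix.mul_apply, Fin.sum_univ_two] <;> ring

lemma antiC_zero : AntiC 0 := fun a => by simp

lemma L_step {l : ℂ} {L : LpE p →L[ℝ] M2}
    (hL : ∀ f, L f = ∫ s in Ioc (0:ℝ) 1, expB (l * ((-2 : ℝ) * s)) * f s) {x t : ℝ}
    (hx : x ∈ Icc (0:ℝ) 1) (ht : t ∈ Icc (0:ℝ) x) {k : M2} (hk : AntiC k) (f : LpE p) :
    L (indL x (k • Rop t f)) = expB (-(l * t)) * k * expB (l * t) * L (indL t f) := by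
  rw [L_ind hL hx, L_ind hL ⟨ht.1, ht.2.trans hx.2⟩, intervalIntegral.integral_of_le hx.1]
  have h1 : ∫ s in Ioc 0 x, expB (l * ((-2 : ℝ) * s)) * (k • Rop t f : LpE p) s =
      ∫ s in Ioc 0 t, expB (l * ((-2 : ℝ) * s)) * (k * f (t - s)) := by
    have : (Ioc (0:ℝ) t) = Ioc 0 x ∩ Ioc 0 t := by
      rw [inter_eq_right.mpr (Ioc_subset_Ioc_right ht.2)]
    rw [this, ← setIntegral_indicator measurableSet_Ioc]
    apply integral_congr_ae
    filter_upwards [ae_restrict_of_ae (Rop_coe t f), ae_restrict_of_ae (Lp.coeFn_smul k (Rop t f))]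
      with s hs hs2
    rw [hs2, Pi.smul_apply, hs]
    by_cases h : s ∈ Ioc 0 t <;> simp [h]
  rw [h1, ← intervalIntegral.integral_of_le ht.1]
  have h2 := intervalIntegral.integral_comp_sub_left (a := 0) (b := t)
    (fun s => expB (l * ((-2 : ℝ) * ((t - s : ℝ)))) * (k * f s)) t
  simp only [sub_sub_cancel, sub_zero, sub_self] at h2
  rw [h2, ← ContinuousLinearMap.mul_apply' ℝ M2 (expB (-(l * t)) * k * expB (l * t)),
    ← ContinuousLinearMap.intervalIntegral_comp_comm]
  · apply intervalIntegral.integral_congr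
    intro s _
    simp only [ContinuousLinearMap.mul_apply']
    have e1 : expB (-(l * t)) * k * expB (l * t) * (expB (l * ((-2 : ℝ) * s)) * f s) =
        expB (-(l * t)) * (k * (expB (l * t) * expB (l * ((-2 : ℝ) * s)))) * f s := by
      simp only [mul_assoc]
    rw [e1, ← expB_add, hk, ← mul_assoc (expB (-(l * t))), ← expB_add, ← mul_assoc]
    congr 3
    push_cast; ring
  · rw [intervalIntegrable_iff_integrableOn_Ioc_of_le ht.1]
    have hi := (L1bound hp.out (Lp.memLp f)).1
    have : IntegrableOn f (Ioc 0 t) := hi.mono_set (Ioc_subset_Ioc_right (ht.2.trans hx.2))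
    have hc : Continuous (fun s : ℝ => expB (l * ((-2 : ℝ) * s))) := expB_cont.comp (by fun_prop)
    obtain ⟨C, hC0, hC⟩ := expB_bdd l (-2)
    refine this.norm.const_mul C |>.mono' ?_ ?_
    · exact hc.aestronglyMeasurable.mul (Lp.memLp f).1.restrict
    · filter_upwards [ae_restrict_mem measurableSet_Ioc] with s hs
      exact (norm_mul_le _ _).trans
        (by gcongr; exact hC s ⟨hs.1.le, hs.2.trans (ht.2.trans hx.2)⟩)

end

section

open MeasureTheory Complex Filter Set
open scoped Matrix.Norms.L2Operator ENNReal


variable {p : ℝ≥0∞} [hp : Fact (1 ≤ p)]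

instance fin01 : IsFiniteMeasure μ01 := by unfold μ01; infer_instance

/-- `B Q` extended by zero outside `(0,1)` -/
def kf (Q : ℝ → M2) : ℝ → M2 := (Ioo (0:ℝ) 1).indicator (fun x => Bmat * Q x)

lemma kf_memLp {Q : ℝ → M2} (hQ : MemLp Q p μ01) : MemLp (kf Q) p volume := by
  unfold kf
  rw [memLp_indicator_iff_restrict measurableSet_Ioo]
  exact hQ.const_mul Bmat

lemma kf_integrable {Q : ℝ → M2} (hQ : MemLp Q p μ01) : Integrable (kf Q) :=
  memLp_one_iff_integrable.mp (kf_memLp (hQ.mono_exponent hp.out))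

lemma kf_sub (Q Q' : ℝ → M2) : kf (fun x => Q x - Q' x) = fun x => kf Q x - kf Q' x := by
  ext1 x
  unfold kf
  by_cases h : x ∈ Ioo (0:ℝ) 1 <;> simp only [h, indicator_of_mem, indicator_of_notMem, not_false_eq_true, mul_sub, sub_zero]

lemma kf_L1 {Q : ℝ → M2} (hQ : MemLp Q p μ01) :
    ∫ t, ‖kf Q t‖ ≤ (eLpNorm (kf Q) p volume).toReal := by
  refine le_trans (le_of_eq ?_) (L1bound hp.out (kf_memLp hQ)).2
  rw [setIntegral_eq_integral_of_forall_compl_eq_zero]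
  intro x hx
  have : x ∉ Ioo (0:ℝ) 1 := fun h => hx (Ioo_subset_Ioc_self h)
  simp [kf, this]

lemma kf_norm_le (Q : ℝ → M2) :
    eLpNorm (kf Q) p volume ≤ ENNReal.ofReal ‖Bmat‖ * eLpNorm Q p μ01 := by
  unfold kf
  rw [eLpNorm_indicator_eq_eLpNorm_restrict measurableSet_Ioo]
  exact eLpNorm_le_mul_eLpNorm_of_ae_le_mul
    (Eventually.of_forall fun x => norm_mul_le _ _) p

lemma kf_antiC {Q : ℝ → M2} (hQ : IsDiracForm Q) (t : ℝ) : AntiC (kf Q t) := by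
  obtain ⟨q1, q2, h⟩ := hQ
  unfold kf
  by_cases ht : t ∈ Ioo (0:ℝ) 1
  · rw [indicator_of_mem ht, h]; exact antiC_dirac _ _
  · rw [indicator_of_notMem ht]; exact antiC_zero

/-- the Volterra equation for the kernel -/
def IsKer (Q : ℝ → M2) (hQ : MemLp Q p μ01) (P : ℝ → LpE p) : Prop :=
  Continuous P ∧ ∀ x ∈ Icc (0:ℝ) 1,
    P x = indL x ((kf_memLp hQ).toLp (kf Q)) + ∫ t in (0:ℝ)..x, kf Q t • Rop t (P t)

lemma smulRop_norm (k : M2) (t : ℝ) (f : LpE p) : ‖k • Rop t f‖ ≤ ‖k‖ * ‖f‖ :=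
  (norm_smul_le _ _).trans (by gcongr; exact Rop_norm t f)

lemma ker_meas (hp' : p ≠ ∞) {Q : ℝ → M2} (hQ : MemLp Q p μ01) {G : ℝ → LpE p}
    (hG : Continuous G) : AEStronglyMeasurable (fun t => kf Q t • Rop t (G t)) volume :=
  (kf_integrable hQ).1.smul (Rop_cont hp' hG).aestronglyMeasurable

lemma ker_exists (hp' : p ≠ ∞) {Q : ℝ → M2} (hQ : MemLp Q p μ01) :
    ∃ P, IsKer Q hQ P := by
  refine volterra_exists (k := fun t => ‖kf Q t‖) (kf_integrable hQ).norm (fun _ => norm_nonneg _)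
    (fun t f => kf Q t • Rop t f) (fun t f => smulRop_norm _ _ _)
    (fun t f g => by rw [Rop_sub, smul_sub]) (fun G hG => ker_meas hp' hQ hG) ?_
  exact (indL_cont hp').comp (continuous_const.prodMk continuous_id)

lemma ker_bound {P : ℝ → LpE p} (hP : Continuous P) :
    ∃ M : ℝ, 0 ≤ M ∧ ∀ x ∈ Icc (0:ℝ) 1, ‖P x‖ ≤ M := by
  obtain ⟨M, hM⟩ := isCompact_Icc.exists_bound_of_continuousOn (s := Icc (0:ℝ) 1) hP.continuousOn
  exact ⟨max M 0, le_max_right _ _, fun s hs => (hM s hs).trans (le_max_left _ _)⟩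

lemma ker_intervalIntegrable (hp' : p ≠ ∞) {Q : ℝ → M2} (hQ : MemLp Q p μ01) {P : ℝ → LpE p}
    (hP : Continuous P) {x : ℝ} (hx : x ∈ Icc (0:ℝ) 1) :
    IntervalIntegrable (fun t => kf Q t • Rop t (P t)) volume 0 x := by
  obtain ⟨M, hM0, hM⟩ := ker_bound hP
  rw [intervalIntegrable_iff_integrableOn_Ioc_of_le hx.1]
  refine ((kf_integrable hQ).norm.mul_const M).integrableOn.mono' (ker_meas hp' hQ hP).restrict ?_
  filter_upwards [ae_restrict_mem measurableSet_Ioc] with t ht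
  exact (smulRop_norm _ _ _).trans (by gcongr; exact hM t ⟨ht.1.le, ht.2.trans hx.2⟩)

lemma ker_dep (hp' : p ≠ ∞) {Q Q' : ℝ → M2} (hQ : MemLp Q p μ01) (hQ' : MemLp Q' p μ01)
    {P P' : ℝ → LpE p} (hP : IsKer Q hQ P) (hP' : IsKer Q' hQ' P') {M : ℝ}
    (hM : ∀ x ∈ Icc (0:ℝ) 1, ‖P x‖ ≤ M) (hM0 : 0 ≤ M) {d N : ℝ}
    (hd : (eLpNorm (kf (fun x => Q x - Q' x)) p volume).toReal ≤ d)
    (hN : (eLpNorm (kf Q') p volume).toReal ≤ N) :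
    ∀ x ∈ Icc (0:ℝ) 1, ‖P x - P' x‖ ≤ 2 * (((1 + M) * d) * Real.exp (2 * N)) := by
  have hd0 : 0 ≤ d := ENNReal.toReal_nonneg.trans hd
  have hQd : MemLp (fun x => Q x - Q' x) p μ01 := hQ.sub hQ'
  have hk' := kf_integrable hQ'
  have hsubc : Continuous (fun t => P t - P' t) := hP.1.sub hP'.1
  have key : ∀ x ∈ Icc (0:ℝ) 1, ‖P x - P' x‖ ≤
      (1 + M) * d + ∫ t in (0:ℝ)..x, ‖kf Q' t‖ * ‖P t - P' t‖ := by
    intro x hx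
    have e1 : P x - P' x = indL x ((kf_memLp hQd).toLp (kf (fun x => Q x - Q' x))) +
        ((∫ t in (0:ℝ)..x, kf (fun x => Q x - Q' x) t • Rop t (P t)) +
        ∫ t in (0:ℝ)..x, kf Q' t • Rop t (P t - P' t)) := by
      rw [hP.2 x hx, hP'.2 x hx, ← intervalIntegral.integral_add
        (ker_intervalIntegrable hp' hQd hP.1 hx)
        (ker_intervalIntegrable hp' hQ' hsubc hx), add_sub_add_comm,
        ← intervalIntegral.integral_sub
        (ker_intervalIntegrable hp' hQ hP.1 hx) (ker_intervalIntegrable hp' hQ' hP'.1 hx),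
        ← map_sub, ← MemLp.toLp_sub]
      congr 1
      · congr 1
        apply MemLp.toLp_congr
        rw [kf_sub]; rfl
      · congr 1
        ext1 t
        rw [kf_sub, Rop_sub, smul_sub, sub_smul]
        abel
    rw [e1]
    have b1 : ‖indL x ((kf_memLp hQd).toLp (kf (fun x => Q x - Q' x)))‖ ≤ d := by
      refine (indL_norm _ _).trans ?_
      rw [Lp.norm_toLp]; exact hd
    have b2 : ‖∫ t in (0:ℝ)..x, kf (fun x => Q x - Q' x) t • Rop t (P t)‖ ≤ d * M := by
      calc _ ≤ ∫ t in (0:ℝ)..x, ‖kf (fun x => Q x - Q' x) t‖ * M := by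
            refine intervalIntegral.norm_integral_le_of_norm_le hx.1 ?_
              ((kf_integrable hQd).norm.mul_const M).intervalIntegrable
            refine Eventually.of_forall fun t ht => (smulRop_norm _ _ _).trans ?_
            gcongr; exact hM t ⟨ht.1.le, ht.2.trans hx.2⟩
        _ = (∫ t in (0:ℝ)..x, ‖kf (fun x => Q x - Q' x) t‖) * M :=
            intervalIntegral.integral_mul_const _ _
        _ ≤ d * M := by
            gcongr
            refine (prim_le (kf_integrable hQd).norm x).trans ?_
            simp only [norm_norm]
            exact (kf_L1 hQd).trans hd
    have b3 : ‖∫ t in (0:ℝ)..x, kf Q' t • Rop t (P t - P' t)‖ ≤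
        ∫ t in (0:ℝ)..x, ‖kf Q' t‖ * ‖P t - P' t‖ := by
      refine intervalIntegral.norm_integral_le_of_norm_le hx.1 ?_ ?_
      · exact Eventually.of_forall fun t ht => smulRop_norm _ _ _
      · exact hk'.norm.intervalIntegrable.mul_continuousOn (hP.1.sub hP'.1).norm.continuousOn
    refine (norm_add_le _ _).trans ?_
    have := norm_add_le (∫ t in (0:ℝ)..x, kf (fun x => Q x - Q' x) t • Rop t (P t))
      (∫ t in (0:ℝ)..x, kf Q' t • Rop t (P t - P' t))
    linarith
  intro x hx
  have := gronwall_L1 hk'.norm (fun _ => norm_nonneg _) (hP.1.sub hP'.1).norm.continuousOn key x hx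
  refine this.trans ?_
  have h0 : 0 ≤ (1 + M) * d := by positivity
  rw [abs_of_nonneg h0]
  gcongr
  simp only [norm_norm]
  exact (kf_L1 hQ').trans hN

lemma intble (l : ℂ) (f : LpE p) {t : ℝ} (ht : t ∈ Icc (0:ℝ) 1) :
    IntervalIntegrable (fun s : ℝ => expB (l * ((-2 : ℝ) * s)) * f s) volume 0 t := by
  rw [intervalIntegrable_iff_integrableOn_Ioc_of_le ht.1]
  have hi := (L1bound hp.out (Lp.memLp f)).1
  have : IntegrableOn f (Ioc 0 t) := hi.mono_set (Ioc_subset_Ioc_right ht.2)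
  have hc : Continuous (fun s : ℝ => expB (l * ((-2 : ℝ) * s))) := expB_cont.comp (by fun_prop)
  obtain ⟨C, hC0, hC⟩ := expB_bdd l (-2)
  refine this.norm.const_mul C |>.mono' ?_ ?_
  · exact hc.aestronglyMeasurable.mul (Lp.memLp f).1.restrict
  · filter_upwards [ae_restrict_mem measurableSet_Ioc] with s hs
    exact (norm_mul_le _ _).trans
      (by gcongr; exact hC s ⟨hs.1.le, hs.2.trans ht.2⟩)

/-- conjugated coefficient -/
def Mc (Q : ℝ → M2) (l : ℂ) (t : ℝ) : M2 := expB (-(l * t)) * kf Q t * expB (l * t)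

lemma Mc_int {Q : ℝ → M2} (hQ : MemLp Q p μ01) (l : ℂ) {Y : ℝ → M2} (hY : Continuous Y) (x : ℝ) :
    IntervalIntegrable (fun t => Mc Q l t * Y t) volume 0 x := by
  have h1 : Continuous (fun t : ℝ => expB (-(l * t))) := expB_cont.comp (by fun_prop)
  have h2 : Continuous (fun t : ℝ => expB (l * t)) := expB_cont.comp (by fun_prop)
  exact (((kf_integrable hQ).intervalIntegrable.continuousOn_mul h1.continuousOn).mul_continuousOn
    h2.continuousOn).mul_continuousOn hY.continuousOn

lemma Y_eq (hp' : p ≠ ∞) {Q : ℝ → M2} (hD : IsDiracForm Q) (hQ : MemLp Q p μ01) {P : ℝ → LpE p}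
    (hP : IsKer Q hQ P) {l : ℂ} {L : LpE p →L[ℝ] M2}
    (hL : ∀ f, L f = ∫ s in Ioc (0:ℝ) 1, expB (l * ((-2 : ℝ) * s)) * f s) {x : ℝ}
    (hx : x ∈ Icc (0:ℝ) 1) :
    1 + L (indL x (P x)) = 1 + ∫ t in (0:ℝ)..x, Mc Q l t * (1 + L (indL t (P t))) := by
  have hYc : Continuous (fun t => L (indL t (P t))) :=
    L.continuous.comp ((indL_cont hp').comp (hP.1.prodMk continuous_id))
  have h1 : L (indL x (indL x ((kf_memLp hQ).toLp (kf Q)))) = ∫ t in (0:ℝ)..x, Mc Q l t * 1 := by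
    rw [L_ind hL hx]
    apply intervalIntegral.integral_congr_ae
    filter_upwards [indL_coe x ((kf_memLp hQ).toLp (kf Q)), (kf_memLp hQ).coeFn_toLp] with s h1 h2 hs
    rw [uIoc_of_le hx.1] at hs
    rw [h1, indicator_of_mem hs, h2, Mc, mul_one, mul_assoc, kf_antiC hD,
      ← mul_assoc (expB (-(l * s))) (expB (-(l * s))), ← expB_add]
    congr 2
    push_cast; ring
  have h2 : L (indL x (∫ t in (0:ℝ)..x, kf Q t • Rop t (P t))) =
      ∫ t in (0:ℝ)..x, Mc Q l t * L (indL t (P t)) := by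
    rw [← ContinuousLinearMap.comp_apply, ← ContinuousLinearMap.intervalIntegral_comp_comm _
      (ker_intervalIntegrable hp' hQ hP.1 hx)]
    apply intervalIntegral.integral_congr
    intro t ht
    rw [uIcc_of_le hx.1] at ht
    simp only [ContinuousLinearMap.comp_apply]
    rw [L_step hL hx ht (kf_antiC hD t), Mc]
  conv_lhs => rw [hP.2 x hx, map_add, map_add, h1, h2]
  rw [← intervalIntegral.integral_add (Mc_int hQ l continuous_const x) (Mc_int hQ l hYc x)]
  simp only [mul_add]

lemma expB_eq (τ : ℂ) : expB τ = Complex.cos τ • (1 : M2) - Complex.sin τ • Bmat := by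
  unfold expB Bmat
  ext i j
  fin_cases i <;> fin_cases j <;> simp

lemma BB : Bmat * Bmat = -1 := by
  unfold Bmat
  ext i j
  fin_cases i <;> fin_cases j <;> simp

lemma expB_deriv (l : ℂ) (t : ℝ) :
    HasDerivAt (fun t : ℝ => expB (-(l * t))) (l • (expB (-(l * t)) * Bmat)) t := by
  simp only [expB_eq]
  have h0 : HasDerivAt (fun z : ℂ => -(l * z)) (-(l * 1)) (t : ℂ) :=
    ((hasDerivAt_id (t : ℂ)).const_mul l).neg
  have hc := (h0.ccos.comp_ofReal.smul_const (1 : M2)).sub (h0.csin.comp_ofReal.smul_const Bmat)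
  convert! hc using 1
  simp only [sub_mul, smul_mul_assoc, one_mul, BB, smul_sub, smul_smul, smul_neg]
  module

lemma expB_ac (l : ℂ) : AbsolutelyContinuousOnInterval (fun t : ℝ => expB (-(l * t))) 0 1 := by
  have hc : Continuous (fun t : ℝ => l • (expB (-(l * t)) * Bmat)) := by
    have h1 : Continuous (fun t : ℝ => expB (-(l * t))) := expB_cont.comp (by fun_prop)
    fun_prop
  have h := ac_primitive (hc.intervalIntegrable (μ := volume) 0 1)
  refine ac_of_dist_le 1 h h ?_
  intro x _ y _
  have hx : ∀ x : ℝ, ∫ t in (0:ℝ)..x, l • (expB (-(l * t)) * Bmat) =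
      expB (-(l * x)) - expB (-(l * (0:ℝ))) := fun x =>
    intervalIntegral.integral_eq_sub_of_hasDerivAt (fun t _ => expB_deriv l t)
      (hc.intervalIntegrable _ _)
  rw [hx, hx, dist_sub_right]
  have := dist_nonneg (x := expB (-(l * x))) (y := expB (-(l * y)))
  linarith

lemma Z_eq {Q : ℝ → M2} (hQ : MemLp Q p μ01) {l : ℂ} {U : ℝ → M2} (hU : IsMatSolution Q l U)
    (hU0 : U 0 = 1) : ∃ V : ℝ → M2, ContinuousOn V (Icc 0 1) ∧ 
    ∀ x ∈ Icc (0:ℝ) 1, U x = V x ∧ 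
    expB (-(l * x)) * V x = 1 + ∫ t in (0:ℝ)..x, Mc Q l t * (expB (-(l * t)) * V t) := by
  obtain ⟨U', hi, hUi, hode⟩ := hU
  have hi' : IntervalIntegrable U' volume 0 1 := by
    rw [intervalIntegrable_iff_integrableOn_Ioo_of_le zero_le_one]; exact hi
  set V : ℝ → M2 := fun x => U 0 + ∫ t in (0:ℝ)..x, U' t with hV
  have hprim := ac_primitive hi'
  have hVc : ContinuousOn V (uIcc 0 1) := continuousOn_const.add hprim.continuousOn
  have he : Continuous (fun t : ℝ => expB (-(l * t))) := expB_cont.comp (by fun_prop)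
  obtain ⟨C1, hC1⟩ := isCompact_uIcc.exists_bound_of_continuousOn hVc
  obtain ⟨C2, hC2⟩ := isCompact_uIcc.exists_bound_of_continuousOn (he.continuousOn (s := uIcc 0 1))
  have hZac : AbsolutelyContinuousOnInterval (fun t : ℝ => expB (-(l * t)) * V t) 0 1 := by
    refine ac_of_dist_le (max C1 C2) (expB_ac l) hprim ?_
    intro x hx y hy
    have e : expB (-(l * x)) * V x - expB (-(l * y)) * V y =
        (expB (-(l * x)) - expB (-(l * y))) * V x + expB (-(l * y)) * (V x - V y) := by noncomm_ring
    have e2 : V x - V y = (∫ t in (0:ℝ)..x, U' t) - ∫ t in (0:ℝ)..y, U' t := by simp [hV]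
    rw [dist_eq_norm, dist_eq_norm, dist_eq_norm, e, ← e2]
    refine (norm_add_le _ _).trans ?_
    rw [mul_add (max C1 C2)]
    refine add_le_add ?_ ?_
    · refine (norm_mul_le _ _).trans ?_
      rw [mul_comm]
      gcongr
      exact (hC1 x hx).trans (le_max_left _ _)
    · refine (norm_mul_le _ _).trans ?_
      gcongr
      exact (hC2 y hy).trans (le_max_right _ _)
  have hUV : ∀ x ∈ Icc (0:ℝ) 1, U x = V x := fun x hx => hUi x hx
  have hode' : ∀ᵐ x : ℝ, x ∈ Ioo (0:ℝ) 1 → Bmat * U' x + Q x * U x = l • U x := by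
    unfold μ01 at hode
    rwa [ae_restrict_iff' measurableSet_Ioo] at hode
  have hend : ∀ᵐ x : ℝ, x ≠ 0 ∧ x ≠ 1 := by
    filter_upwards [Measure.ae_ne volume 0, Measure.ae_ne volume 1] with x h1 h2 using ⟨h1, h2⟩
  have hMi : IntervalIntegrable (fun t => Mc Q l t * (expB (-(l * t)) * V t)) volume 0 1 := by
    have h2 : Continuous (fun t : ℝ => expB (l * t)) := expB_cont.comp (by fun_prop)
    exact (((kf_integrable hQ).intervalIntegrable.continuousOn_mul he.continuousOn).mul_continuousOn
      h2.continuousOn).mul_continuousOn (he.continuousOn.mul hVc)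
  have hftc := ac_ftc hZac hMi (by
    filter_upwards [hi'.ae_hasDerivAt_integral, hode', hend] with x h1 h2 h3 hx
    have hx' := hx
    rw [uIcc_of_le zero_le_one] at hx'
    have hxo : x ∈ Ioo (0:ℝ) 1 := ⟨lt_of_le_of_ne hx'.1 (Ne.symm h3.1), lt_of_le_of_ne hx'.2 h3.2⟩
    have hd : HasDerivAt V (U' x) x := (h1 hx 0 (by simp)).const_add _
    have hm := (expB_deriv l x).mul hd
    convert! hm using 1
    have hU' : U' x = Bmat * Q x * V x - l • (Bmat * V x) := by
      have h4 := congrArg (fun A => Bmat * A) (h2 hxo)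
      simp only [mul_add, ← mul_assoc, BB, hUV x hx', mul_smul_comm] at h4
      rw [← h4]; simp
    have hk : kf Q x = Bmat * Q x := by unfold kf; rw [indicator_of_mem hxo]
    rw [hU', Mc, hk, mul_assoc _ (expB (l * x)), ← mul_assoc (expB (l * x)), expB_mul_neg, one_mul,
      mul_sub, mul_smul_comm, smul_mul_assoc]
    simp only [mul_assoc]
    abel)
  refine ⟨V, by rwa [uIcc_of_le zero_le_one] at hVc, fun x hx => ⟨hUV x hx, ?_⟩⟩
  rw [hftc x (by rwa [uIcc_of_le zero_le_one])]
  simp [hV, hU0, expB_zero]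

lemma repr_formula (hp' : p ≠ ∞) {Q : ℝ → M2} (hD : IsDiracForm Q) (hQ : MemLp Q p μ01)
    {P : ℝ → LpE p} (hP : IsKer Q hQ P) {l : ℂ} {U : ℝ → M2} (hU : IsMatSolution Q l U)
    (hU0 : U 0 = 1) {x : ℝ} (hx : x ∈ Icc (0:ℝ) 1) :
    U x = expB (l * x) + ∫ s in (0:ℝ)..x, expB (l * (x - 2 * s)) * P x s := by
  obtain ⟨L, hL⟩ := Lfun_exists (p := p) l
  obtain ⟨V, hVc, hV⟩ := Z_eq hQ hU hU0
  have hYc : Continuous (fun t => 1 + L (indL t (P t))) :=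
    continuous_const.add (L.continuous.comp ((indL_cont hp').comp (hP.1.prodMk continuous_id)))
  have he : Continuous (fun t : ℝ => expB (-(l * t))) := expB_cont.comp (by fun_prop)
  have h2 : Continuous (fun t : ℝ => expB (l * t)) := expB_cont.comp (by fun_prop)
  obtain ⟨C1, hC1⟩ := isCompact_Icc.exists_bound_of_continuousOn (he.continuousOn (s := Icc 0 1))
  obtain ⟨C2, hC2⟩ := isCompact_Icc.exists_bound_of_continuousOn (h2.continuousOn (s := Icc 0 1))
  have hC10 : 0 ≤ C1 := (norm_nonneg _).trans (hC1 0 (by simp))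
  have hC20 : 0 ≤ C2 := (norm_nonneg _).trans (hC2 0 (by simp))
  set W : ℝ → M2 := fun t => expB (-(l * t)) * V t - (1 + L (indL t (P t))) with hW
  have hWc : ContinuousOn W (Icc 0 1) := (he.continuousOn.mul hVc).sub hYc.continuousOn
  have hki : Integrable (fun t => C1 * ‖kf Q t‖ * C2) :=
    ((kf_integrable hQ).norm.const_mul C1).mul_const C2
  have hgr := gronwall_L1 hki (fun t => by positivity) hWc.norm (a := 0) (by
    intro x hx
    have hsub : uIcc 0 x ⊆ Icc (0:ℝ) 1 := by
      rw [uIcc_of_le hx.1]; exact Icc_subset_Icc_right hx.2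
    have e : W x = ∫ t in (0:ℝ)..x, Mc Q l t * W t := by
      simp only [hW, mul_sub]
      rw [intervalIntegral.integral_sub, (hV x hx).2, Y_eq hp' hD hQ hP hL hx]
      · abel
      · exact (((kf_integrable hQ).intervalIntegrable.continuousOn_mul
          he.continuousOn).mul_continuousOn
          h2.continuousOn).mul_continuousOn (he.continuousOn.mul (hVc.mono hsub))
      · exact Mc_int hQ l hYc x
    rw [e, zero_add]
    refine intervalIntegral.norm_integral_le_of_norm_le hx.1 ?_ ?_
    · refine Eventually.of_forall fun t ht => (norm_mul_le _ _).trans ?_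
      gcongr
      have ht' : t ∈ Icc (0:ℝ) 1 := ⟨ht.1.le, ht.2.trans hx.2⟩
      refine (norm_mul_le _ _).trans ?_
      gcongr
      · refine (norm_mul_le _ _).trans ?_
        gcongr
        exact hC1 t ht'
      · exact hC2 t ht'
    · exact hki.intervalIntegrable.mul_continuousOn (hWc.norm.mono hsub))
  have hW0 : W x = 0 := by
    have := hgr x hx
    simpa using this
  have hZ : expB (-(l * x)) * V x = 1 + L (indL x (P x)) := sub_eq_zero.mp hW0
  have hVx : V x = expB (l * x) * (1 + L (indL x (P x))) := by
    rw [← hZ, ← mul_assoc, expB_mul_neg, one_mul]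
  rw [(hV x hx).1, hVx, mul_add, mul_one, L_ind hL hx,
    ← ContinuousLinearMap.mul_apply' ℝ M2 (expB (l * x)),
    ← ContinuousLinearMap.intervalIntegral_comp_comm _ (intble l (P x) hx)]
  congr 1
  apply intervalIntegral.integral_congr
  intro s _
  simp only [ContinuousLinearMap.mul_apply']
  rw [← mul_assoc, ← expB_add]
  congr 2
  push_cast; ring

lemma eLp_sub_le (f g : LpE p) :
    eLpNorm (fun s => f s - g s) p μ01 ≤ ENNReal.ofReal ‖f - g‖ := by
  rw [Lp.norm_def, ENNReal.ofReal_toReal (Lp.memLp _).2.ne, eLpNorm_congr_ae (Lp.coeFn_sub f g)]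
  exact eLpNorm_mono_measure _ Measure.restrict_le_self

theorem main_thm (hp' : p ≠ ∞) :
    ∃ P : (ℝ → M2) → ℝ → ℝ → M2,
      (∀ Q : ℝ → M2, IsDiracForm Q → MemLp Q p μ01 →
        (∀ l : ℂ, ∀ U : ℝ → M2, IsMatSolution Q l U → U 0 = 1 →
          ∀ x ∈ Set.Icc (0:ℝ) 1,
            U x = expB (l * x) + ∫ s in (0:ℝ)..x, expB (l * (x - 2 * s)) * P Q x s) ∧
        (∀ x ∈ Set.Icc (0:ℝ) 1, MemLp (P Q x) p μ01) ∧
        (∀ x₀ ∈ Set.Icc (0:ℝ) 1, ∀ ε > (0:ℝ), ∃ δ > (0:ℝ), ∀ x ∈ Set.Icc (0:ℝ) 1,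
          |x - x₀| < δ →
            eLpNorm (fun s => P Q x s - P Q x₀ s) p μ01 < ENNReal.ofReal ε)) ∧
      (∀ Q : ℝ → M2, IsDiracForm Q → MemLp Q p μ01 → ∀ ε > (0:ℝ), ∃ δ > (0:ℝ),
        ∀ Q' : ℝ → M2, IsDiracForm Q' → MemLp Q' p μ01 →
          eLpNorm (fun x => Q x - Q' x) p μ01 < ENNReal.ofReal δ →
          ∀ x ∈ Set.Icc (0:ℝ) 1,
            eLpNorm (fun s => P Q x s - P Q' x s) p μ01 < ENNReal.ofReal ε) := by
  classical
  have hex : ∀ Q : ℝ → M2, ∃ P : ℝ → LpE p, ∀ hQ : MemLp Q p μ01, IsKer Q hQ P := by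
    intro Q
    by_cases hQ : MemLp Q p μ01
    · obtain ⟨P, hP⟩ := ker_exists hp' hQ
      exact ⟨P, fun _ => hP⟩
    · exact ⟨fun _ => 0, fun h => absurd h hQ⟩
  choose P hP using hex
  refine ⟨fun Q x s => P Q x s, fun Q hD hQ => ⟨?_, ?_, ?_⟩, ?_⟩
  · intro l U hU hU0 x hx
    exact repr_formula hp' hD hQ (hP Q hQ) hU hU0 hx
  · intro x _
    exact (Lp.memLp (P Q x)).restrict _
  · intro x₀ _ ε hε
    obtain ⟨δ, hδ, h⟩ := Metric.continuous_iff.mp (hP Q hQ).1 x₀ ε hε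
    refine ⟨δ, hδ, fun x _ hx => (eLp_sub_le _ _).trans_lt ?_⟩
    rw [ENNReal.ofReal_lt_ofReal_iff hε, ← dist_eq_norm]
    exact h x hx
  · intro Q hD hQ ε hε
    obtain ⟨M, hM0, hM⟩ := ker_bound (hP Q hQ).1
    set N := (eLpNorm (kf Q) p volume).toReal + 1 with hN
    set b := ‖Bmat‖ with hb
    have hb0 : 0 ≤ b := norm_nonneg _
    set D := 2 * ((1 + M) * (b + 1) * Real.exp (2 * N)) with hDdef
    have hDpos : 0 < D := by positivity
    refine ⟨min (1 / (b + 1)) (ε / (2 * D)), by positivity, fun Q' hD' hQ' hlt x hx => ?_⟩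
    set δ := min (1 / (b + 1)) (ε / (2 * D)) with hδ
    have hδ0 : 0 < δ := by positivity
    have hδ1 : (b + 1) * δ ≤ 1 := by
      calc (b + 1) * δ ≤ (b + 1) * (1 / (b + 1)) := by gcongr; exact min_le_left _ _
        _ = 1 := by field_simp
    have hδ2 : D * δ ≤ ε / 2 := by
      calc D * δ ≤ D * (ε / (2 * D)) := by gcongr; exact min_le_right _ _
        _ = ε / 2 := by field_simp
    have hd : (eLpNorm (kf (fun x => Q x - Q' x)) p volume).toReal ≤ (b + 1) * δ := by
      refine ENNReal.toReal_le_of_le_ofReal (by positivity) ((kf_norm_le _).trans ?_)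
      rw [ENNReal.ofReal_mul (by positivity)]
      gcongr
      linarith
    have hNN : (eLpNorm (kf Q') p volume).toReal ≤ N := by
      have e1 : kf Q' = kf Q - kf (fun x => Q x - Q' x) := by
        rw [kf_sub]; ext1 t; simp
      have hm : MemLp (kf (fun x => Q x - Q' x)) p volume := kf_memLp (hQ.sub hQ')
      have h1 : eLpNorm (kf Q') p volume ≤
          eLpNorm (kf Q) p volume + eLpNorm (kf (fun x => Q x - Q' x)) p volume := by
        conv_lhs => rw [e1]
        exact eLpNorm_sub_le (kf_memLp hQ).1 hm.1 hp.out
      have h2 := ENNReal.toReal_mono (ENNReal.add_ne_top.mpr ⟨(kf_memLp hQ).2.ne, hm.2.ne⟩) h1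
      rw [ENNReal.toReal_add (kf_memLp hQ).2.ne hm.2.ne] at h2
      linarith
    refine (eLp_sub_le _ _).trans_lt ?_
    rw [ENNReal.ofReal_lt_ofReal_iff hε]
    have := ker_dep hp' hQ hQ' (hP Q hQ) (hP Q' hQ') hM hM0 hd hNN x hx
    have e : 2 * ((1 + M) * ((b + 1) * δ) * Real.exp (2 * N)) = D * δ := by rw [hDdef]; ring
    linarith

end

/-- Integral representation of the Cauchy matrix `U(x,λ)` of
`B U' + Q U = λ U`, `U(0) = I`, with a kernel `P_Q` whose slices lie in `L_p`, depend
continuously on `x`, and depend continuously on `Q`. -/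
theorem statement0 (p : ℝ≥0∞) (hp : 1 ≤ p) (hp' : p ≠ ∞) :
    ∃ P : (ℝ → M2) → ℝ → ℝ → M2,
      (∀ Q : ℝ → M2, IsDiracForm Q → MemLp Q p μ01 →
        -- (i) the integral representation of the Cauchy matrix
        (∀ l : ℂ, ∀ U : ℝ → M2, IsMatSolution Q l U → U 0 = 1 →
          ∀ x ∈ Set.Icc (0:ℝ) 1,
            U x = expB (l * x) + ∫ s in (0:ℝ)..x, expB (l * (x - 2 * s)) * P Q x s) ∧
        -- (ii) each slice `P(x,·)` belongs to `L_p(M₂)`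
        (∀ x ∈ Set.Icc (0:ℝ) 1, MemLp (P Q x) p μ01) ∧
        -- (iii) the map `x ↦ P(x,·) ∈ L_p(M₂)` is continuous on `[0,1]`
        (∀ x₀ ∈ Set.Icc (0:ℝ) 1, ∀ ε > (0:ℝ), ∃ δ > (0:ℝ), ∀ x ∈ Set.Icc (0:ℝ) 1,
          |x - x₀| < δ →
            eLpNorm (fun s => P Q x s - P Q x₀ s) p μ01 < ENNReal.ofReal ε)) ∧
      -- (iv) continuity of `Q ↦ P_Q` into `C([0,1], L_p(M₂))`
      (∀ Q : ℝ → M2, IsDiracForm Q → MemLp Q p μ01 → ∀ ε > (0:ℝ), ∃ δ > (0:ℝ),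
        ∀ Q' : ℝ → M2, IsDiracForm Q' → MemLp Q' p μ01 →
          eLpNorm (fun x => Q x - Q' x) p μ01 < ENNReal.ofReal δ →
          ∀ x ∈ Set.Icc (0:ℝ) 1,
            eLpNorm (fun s => P Q x s - P Q' x s) p μ01 < ENNReal.ofReal ε) := by
  haveI : Fact (1 ≤ p) := ⟨hp⟩
  exact main_thm hp'
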